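/- Let H_l be a super spherical harmonic of degree l. Then H_l(∂_x) exp(x²/2) = H_l(x) exp(x²/2), where H_l(∂_x) denotes the constant-coefficient differential operator obtained from H_l by substituting in each monomial x_i → −∂_{x_i}, x`_{2i} → 2∂_{x`_{2i−1}} and x`_{2i−1} → −2∂_{x`_{2i}} (this is well defined since the substituted operators satisfy the same commutation and anticommutation relations as the variables), and exp(x²/2) = exp(−(x_1²+⋯+x_m²)/2)·Σ_{j=0}^n (x`²)^j/(2^j j!) with x`² = Σ_{j=1}^n x`_{2j−1} x`_{2j}. -/

import Mathlib

open scoped BigOperators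
open Finset MeasureTheory

noncomputable section

/-- The Grassmann algebra on `N` anticommuting generators with coefficients in a
commutative ring `R`, represented by its coefficients with respect to the basis of
increasingly-ordered monomials, indexed by subsets of the generators. -/
abbrev Gr (R : Type) (N : ℕ) : Type := Finset (Fin N) → R

namespace Gr

variable {R : Type} [CommRing R] {N : ℕ}

/-- The sign produced when reordering the concatenation of the ordered monomials indexed
by `A` and `B` into the ordered monomial indexed by `A ∪ B`. -/
def msign (A B : Finset (Fin N)) : R :=
  (-1 : R) ^ (((A ×ˢ B).filter fun p => p.2 < p.1).card)

/-- Multiplication of the Grassmann algebra. -/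
def mul (f g : Gr R N) : Gr R N :=
  fun s => ∑ A ∈ s.powerset, msign A (s \ A) * f A * g (s \ A)

/-- The unit of the Grassmann algebra. -/
def one : Gr R N := fun s => if s = (∅ : Finset (Fin N)) then 1 else 0

/-- The `j`-th generator of the Grassmann algebra. -/
def gen (j : Fin N) : Gr R N := fun s => if s = {j} then 1 else 0

/-- Powers in the Grassmann algebra. -/
def pow (f : Gr R N) : ℕ → Gr R N
  | 0 => one
  | k + 1 => mul (pow f k) f

/-- The left partial derivative `∂_j`, i.e. the odd derivation with `∂_j(x_k) = δ_{jk}`. -/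
def pderiv (j : Fin N) (f : Gr R N) : Gr R N :=
  fun s => if j ∈ s then 0
    else (-1 : R) ^ ((s.filter fun i => i < j).card) * f (insert j s)

/-- The exponential of a Grassmann algebra element with nilpotent (zero-constant-term)
argument: the series terminates, and all terms beyond degree `N` vanish. -/
def gexp (f : Gr ℂ N) : Gr ℂ N :=
  ∑ k ∈ Finset.range (N + 1), ((k.factorial : ℂ))⁻¹ • pow f k

/-- Iterated left partial derivatives: the first element of the list acts first. -/
def derivList (l : List (Fin N)) (f : Gr R N) : Gr R N :=
  l.foldl (fun g j => pderiv j g) f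

/-- Complex conjugation of the coefficients. -/
def gconj (f : Gr ℂ N) : Gr ℂ N := fun s => (starRingEnd ℂ) (f s)

end Gr

/-- The Lean index of the paper's generator `x`_{2j-1}` (j = 1,…,n). -/
def lo (n : ℕ) (j : Fin n) : Fin (2 * n) := ⟨2 * (j : ℕ), by have := j.isLt; omega⟩

/-- The Lean index of the paper's generator `x`_{2j}` (j = 1,…,n). -/
def hi (n : ℕ) (j : Fin n) : Fin (2 * n) := ⟨2 * (j : ℕ) + 1, by have := j.isLt; omega⟩

/-- `x`² = Σ_{j=1}^n x`_{2j-1} x`_{2j}`. -/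
def xsq (n : ℕ) : Gr ℂ (2 * n) := ∑ j : Fin n, Gr.mul (Gr.gen (lo n j)) (Gr.gen (hi n j))

/-- The fermionic Laplace operator `Δ_f = 4 Σ_{j=1}^n ∂_{x`_{2j-1}} ∂_{x`_{2j}}`. -/
def lapF (n : ℕ) (f : Gr ℂ (2 * n)) : Gr ℂ (2 * n) :=
  (4 : ℂ) • ∑ j : Fin n, Gr.pderiv (lo n j) (Gr.pderiv (hi n j) f)

/-- The Berezin integral `∫_B = π^{-n} ∂_{x`_{2n}} ⋯ ∂_{x`_1}`. -/
def berezin (n : ℕ) (f : Gr ℂ (2 * n)) : ℂ :=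
  ((Real.pi : ℂ) ^ n)⁻¹ * Gr.derivList (List.finRange (2 * n)) f ∅

/-- The fermionic Gaussian `exp(x`²/2) = Σ_{j=0}^n (x`²)^j/(2^j j!)`. -/
def fermGauss (n : ℕ) : Gr ℂ (2 * n) :=
  ∑ j ∈ Finset.range (n + 1), (((2 : ℂ) ^ j * j.factorial)⁻¹) • Gr.pow (xsq n) j

/-- Embedding of the `x` generators into the Grassmann algebra on the `4n` generators
`x`_1, …, x`_{2n}, y`_1, …, y`_{2n}` (the `x` generators come first). -/
def xi (n : ℕ) (t : Fin (2 * n)) : Fin (2 * n + 2 * n) := Fin.castAdd (2 * n) t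

/-- Embedding of the `y` generators into the Grassmann algebra on the `4n` generators. -/
def yi (n : ℕ) (t : Fin (2 * n)) : Fin (2 * n + 2 * n) := Fin.natAdd (2 * n) t

/-- The algebra embedding `Λ_{2n} → Λ_{4n}` sending the generators to the `x` generators. -/
def embX (n : ℕ) (f : Gr ℂ (2 * n)) : Gr ℂ (2 * n + 2 * n) :=
  fun s => ∑ A : Finset (Fin (2 * n)), if s = A.image (xi n) then f A else 0

/-- The Berezin integral with respect to the `x` variables,
`π^{-n} ∂_{x`_{2n}} ⋯ ∂_{x`_1}`, inside the mixed algebra `Λ_{4n}`. -/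
def berezinX (n : ℕ) (F : Gr ℂ (2 * n + 2 * n)) : Gr ℂ (2 * n + 2 * n) :=
  ((Real.pi : ℂ) ^ n)⁻¹ • Gr.derivList ((List.finRange (2 * n)).map (xi n)) F

/-- The fermionic Fourier kernel
`K^σ(x, y) = exp(-σ (i/2) Σ_{j=1}^n (x`_{2j-1} y`_{2j} - x`_{2j} y`_{2j-1}))`
(for the plus sign `σ = 1`, for the minus sign `σ = -1`). -/
def fermK (n : ℕ) (σ : ℂ) : Gr ℂ (2 * n + 2 * n) :=
  Gr.gexp ((-σ * (Complex.I / 2)) • ∑ j : Fin n,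
    (Gr.mul (Gr.gen (xi n (lo n j))) (Gr.gen (yi n (hi n j))) -
     Gr.mul (Gr.gen (xi n (hi n j))) (Gr.gen (yi n (lo n j)))))

/-- The fermionic Fourier transform
`F^σ_{0|2n}(g)(y) = (2π)^n ∫_{B,x} K^σ(x,y) g(x)`, an element of the Grassmann algebra
in the `y` variables, identified with `Λ_{2n}`. -/
def fermFT (n : ℕ) (σ : ℂ) (g : Gr ℂ (2 * n)) : Gr ℂ (2 * n) :=
  fun s => (((2 * Real.pi : ℝ) : ℂ) ^ n) *
    berezinX n (Gr.mul (fermK n σ) (embX n g)) (s.image (yi n))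


end
noncomputable section

/-- Functions on `ℝ^m` with values in the Grassmann algebra `Λ_{2n}`; the elements with
Schwartz coefficients form the space `S(ℝ^m)_{m|2n}`. -/
abbrev SF (m n : ℕ) : Type := ((Fin m) → ℝ) → Gr ℂ (2 * n)

/-- `f ∈ S(ℝ^m)_{m|2n}`: every Grassmann coefficient of `f` is a Schwartz function. -/
def IsSchwartz (m n : ℕ) (f : SF m n) : Prop :=
  ∀ s : Finset (Fin (2 * n)), ∃ φ : SchwartzMap ((Fin m) → ℝ) ℂ, ∀ x, f x s = φ x

/-- The super Fourier transform
`F^σ_{m|2n}(f)(y) = (2π)^{-M/2} ∫_{ℝ^m} dV(x) ∫_{B,x} exp(σ i Σ_i x_i y_i) K^σ(x,y) f(x)`,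
with `M = m - 2n` (plus sign: `σ = 1`; minus sign: `σ = -1`). -/
def superFT (m n : ℕ) (σ : ℂ) (f : SF m n) : SF m n :=
  fun y s => (((2 * Real.pi : ℝ) : ℂ) ^ ((-((m : ℂ) - 2 * (n : ℂ))) / 2)) *
    ∫ x : (Fin m) → ℝ, Complex.exp (σ * Complex.I * ∑ i, (x i : ℂ) * (y i : ℂ)) *
      berezinX n (Gr.mul (fermK n σ) (embX n (f x))) (s.image (yi n))

/-- The partial derivative `∂_{x_i}` of a `Λ_{2n}`-valued function, acting coefficientwise. -/
def bderiv (m n : ℕ) (i : Fin m) (f : SF m n) : SF m n :=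
  fun x s => fderiv ℝ (fun t => f t s) x (Pi.single i 1)

/-- The super Laplace operator `Δ = 4 Σ_j ∂_{x`_{2j-1}} ∂_{x`_{2j}} - Σ_j ∂_{x_j}²`. -/
def superLap (m n : ℕ) (f : SF m n) : SF m n :=
  fun x => lapF n (f x) - ∑ i : Fin m, bderiv m n i (bderiv m n i f) x

/-- The element `x² = Σ_{j=1}^n x`_{2j-1} x`_{2j} - Σ_{j=1}^m x_j²` at the point `x`. -/
def xsqElem (m n : ℕ) (x : (Fin m) → ℝ) : Gr ℂ (2 * n) :=
  xsq n + (-(∑ i : Fin m, ((x i : ℂ)) ^ 2)) • Gr.one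

/-- The super Gaussian `exp(x²/2) = exp(-(x_1²+⋯+x_m²)/2) Σ_{j=0}^n (x`²)^j/(2^j j!)`. -/
def gaussFun (m n : ℕ) : SF m n :=
  fun x => ((Real.exp (-(∑ i : Fin m, (x i) ^ 2) / 2) : ℝ) : ℂ) • fermGauss n

/-- The Euler operator `𝔼 = Σ_j x_j ∂_{x_j} + Σ_j x`_j ∂_{x`_j}`. -/
def euler (m n : ℕ) (f : SF m n) : SF m n :=
  fun x => (∑ i : Fin m, ((x i : ℂ)) • bderiv m n i f x) +
    ∑ t : Fin (2 * n), Gr.mul (Gr.gen t) (Gr.pderiv t (f x))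

/-- The super integral `∫_{ℝ^{m|2n}} f = ∫_{ℝ^m} dV(x) ∫_B f`. -/
def superInt (m n : ℕ) (f : SF m n) : ℂ := ∫ x : (Fin m) → ℝ, berezin n (f x)

end
noncomputable section

/-- Elements of `ℂ[x_1,…,x_m] ⊗ Λ_{2n}`: Grassmann elements whose coefficients are
polynomials in the commuting variables. -/
abbrev PG (m n : ℕ) : Type := Gr (MvPolynomial (Fin m) ℂ) (2 * n)

/-- `H` is homogeneous of total degree `l`, counting both commuting and
anticommuting variables. -/
def PHomog (m n : ℕ) (H : PG m n) (l : ℕ) : Prop :=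
  ∀ s : Finset (Fin (2 * n)), ∀ d ∈ (H s).support, (d.sum fun _ e => e) + s.card = l

/-- The super Laplace operator `Δ = 4 Σ_j ∂_{x`_{2j-1}} ∂_{x`_{2j}} - Σ_j ∂_{x_j}²`
on `ℂ[x_1,…,x_m] ⊗ Λ_{2n}`. -/
def superLapP (m n : ℕ) (H : PG m n) : PG m n :=
  fun s => (4 : MvPolynomial (Fin m) ℂ) *
      (∑ j : Fin n, Gr.pderiv (lo n j) (Gr.pderiv (hi n j) H) s)
    - ∑ i : Fin m, MvPolynomial.pderiv i (MvPolynomial.pderiv i (H s))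

/-- Evaluation of an element of `ℂ[x_1,…,x_m] ⊗ Λ_{2n}` at the point `x ∈ ℝ^m`,
giving a `Λ_{2n}`-valued function. -/
def evalP (m n : ℕ) (H : PG m n) : SF m n :=
  fun x s => MvPolynomial.eval (fun i => ((x i : ℝ) : ℂ)) (H s)

end
noncomputable section

/-- The odd operator substituted for the generator indexed `t`: the paper's substitution
`x`_{2i} → 2 ∂_{x`_{2i-1}}` and `x`_{2i-1} → -2 ∂_{x`_{2i}}`. -/
def Dop (n : ℕ) (t : Fin (2 * n)) (g : Gr ℂ (2 * n)) : Gr ℂ (2 * n) :=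
  if h : (t : ℕ) % 2 = 0 then
    (-2 : ℂ) • Gr.pderiv ⟨(t : ℕ) + 1, by have := t.isLt; omega⟩ g
  else
    (2 : ℂ) • Gr.pderiv ⟨(t : ℕ) - 1, by have := t.isLt; omega⟩ g

/-- The operator substituted for the commuting variable `x_i`, namely `-∂_{x_i}`. -/
def bosD (m n : ℕ) (i : Fin m) (f : SF m n) : SF m n :=
  fun x s => -(fderiv ℝ (fun t => f t s) x (Pi.single i 1))

/-- Composition of a list of operators (the head acting outermost). -/
def opProd {m n : ℕ} (l : List (SF m n → SF m n)) : SF m n → SF m n :=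
  l.foldr (· ∘ ·) id

/-- The operator substituted for the commuting monomial `x^d`. -/
def bosMono (m n : ℕ) (d : (Fin m) →₀ ℕ) : SF m n → SF m n :=
  opProd ((List.finRange m).map fun i => (bosD m n i)^[d i])

/-- The operator substituted for the Grassmann monomial indexed by `A` (written in
increasing order of the generators). -/
def grassOp (m n : ℕ) (A : Finset (Fin (2 * n))) : SF m n → SF m n :=
  opProd ((A.sort (· ≤ ·)).map fun t => fun (F : SF m n) x => Dop n t (F x))

/-- The constant-coefficient differential operator `p(∂_x)` obtained from
`p ∈ ℂ[x_1,…,x_m] ⊗ Λ_{2n}` by substituting `x_i → -∂_{x_i}`,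
`x`_{2i} → 2∂_{x`_{2i-1}}` and `x`_{2i-1} → -2∂_{x`_{2i}}`. -/
def pOp (m n : ℕ) (H : PG m n) (F : SF m n) : SF m n :=
  ∑ A : Finset (Fin (2 * n)), ∑ d ∈ (H A).support,
    MvPolynomial.coeff d (H A) • bosMono m n d (grassOp m n A F)

end

noncomputable section

section TruncatedExponential

variable {V : Type*} [AddCommGroup V] [Module ℂ V]

/-- The truncated exponential series `∑_{k < K} (Δ/2)^k / k!`. -/
def truncExp (Δ : Module.End ℂ V) (K : ℕ) : Module.End ℂ V :=
  ∑ k ∈ range K, ((2 : ℂ) ^ k * k.factorial)⁻¹ • Δ ^ k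

theorem pow_succ_mul_of_central_commutator {Δ X C : Module.End ℂ V}
    (hX : Δ * X = X * Δ + (2 : ℂ) • C) (hC : Δ * C = C * Δ) (k : ℕ) :
    Δ ^ (k + 1) * X = X * Δ ^ (k + 1) + (2 * ((k + 1 : ℕ) : ℂ)) • (C * Δ ^ k) := by
  induction k with
  | zero => simp [hX]
  | succ k ih =>
    rw [pow_succ' Δ (k + 1), mul_assoc, ih, mul_add, ← mul_assoc, hX, mul_smul_comm,
      ← mul_assoc Δ C, hC, mul_assoc C Δ, ← pow_succ' Δ k, add_mul, smul_mul_assoc,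
      mul_assoc X Δ, add_assoc, ← add_smul]
    push_cast
    congr 2
    ring

theorem truncExp_succ_mul {Δ X C : Module.End ℂ V}
    (hX : Δ * X = X * Δ + (2 : ℂ) • C) (hC : Δ * C = C * Δ) (K : ℕ) :
    truncExp Δ (K + 1) * X = X * truncExp Δ (K + 1) + C * truncExp Δ K := by
  simp only [truncExp, sum_range_succ' _ K, add_mul, mul_add, sum_mul, mul_sum, smul_mul_assoc,
    mul_smul_comm, pow_succ_mul_of_central_commutator hX hC, smul_add, sum_add_distrib]
  have h : ∀ k : ℕ, ((2 : ℂ) ^ (k + 1) * (k + 1).factorial)⁻¹ • (2 * ((k + 1 : ℕ) : ℂ)) • (C * Δ ^ k)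
      = ((2 : ℂ) ^ k * k.factorial)⁻¹ • (C * Δ ^ k) := by
    intro k
    rw [smul_smul]
    congr 1
    have h1 : (k.factorial : ℂ) ≠ 0 := by exact_mod_cast k.factorial_ne_zero
    have h2 : (k + 1 : ℂ) ≠ 0 := by exact_mod_cast k.succ_ne_zero
    rw [Nat.factorial_succ]
    push_cast
    field_simp
    ring
  simp only [h, pow_zero, one_mul, mul_one]
  abel

theorem truncExp_succ_apply_of_pow_eq_zero {Δ : Module.End ℂ V} {K : ℕ} {v : V}
    (h : (Δ ^ K) v = 0) : truncExp Δ (K + 1) v = truncExp Δ K v := by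
  simp [truncExp, sum_range_succ, h]

theorem truncExp_apply_of_apply_eq_zero {Δ : Module.End ℂ V} {v : V} (h : Δ v = 0) (K : ℕ) :
    truncExp Δ (K + 1) v = v := by
  simp [truncExp, sum_range_succ', pow_succ, h]

end TruncatedExponential

namespace Gr

variable {R : Type} [CommRing R] {N : ℕ}

/-- The sign picked up when moving the generator `t` past the generators in `s` below it. -/
def gsign (R : Type) [CommRing R] (t : Fin N) (s : Finset (Fin N)) : R :=
  (-1 : R) ^ ((s.filter fun i => i < t).card)

theorem gsign_mul_self (t : Fin N) (s : Finset (Fin N)) : gsign R t s * gsign R t s = 1 := by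
  rw [gsign, ← mul_pow]
  simp

theorem gsign_insert_self (t : Fin N) (s : Finset (Fin N)) :
    gsign R t (insert t s) = gsign R t s := by
  simp [gsign, filter_insert]

theorem gsign_erase_self (t : Fin N) (s : Finset (Fin N)) :
    gsign R t (s.erase t) = gsign R t s := by
  have h : (s.erase t).filter (fun i => i < t) = s.filter fun i => i < t := by
    ext i
    simp only [mem_filter, mem_erase]
    exact ⟨fun h => ⟨h.1.2, h.2⟩, fun h => ⟨⟨h.2.ne, h.1⟩, h.2⟩⟩
  rw [gsign, h, gsign]

theorem gsign_insert {t u : Fin N} {s : Finset (Fin N)} (hu : u ∉ s) :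
    gsign R t (insert u s) = (if u < t then -1 else 1) * gsign R t s := by
  unfold gsign
  rw [filter_insert]
  split_ifs with h
  · rw [card_insert_of_notMem (by simp [hu]), pow_succ]
    ring
  · simp

theorem gsign_erase {t u : Fin N} {s : Finset (Fin N)} (hu : u ∈ s) :
    gsign R t (s.erase u) = (if u < t then -1 else 1) * gsign R t s := by
  have h := gsign_insert (R := R) (t := t) (notMem_erase u s)
  rw [insert_erase hu] at h
  rw [h, ← mul_assoc]
  split_ifs <;> simp

/-- The left derivative `∂_t` as a linear map. -/
def pderivL (t : Fin N) : Module.End R (Gr R N) where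
  toFun := pderiv t
  map_add' f g := by
    ext s
    simp only [pderiv, Pi.add_apply]
    split_ifs <;> ring
  map_smul' c f := by
    ext s
    simp only [pderiv, Pi.smul_apply, smul_eq_mul, RingHom.id_apply]
    split_ifs <;> ring

/-- Left multiplication by the generator `t` as a linear map. -/
def genMul (t : Fin N) : Module.End R (Gr R N) where
  toFun f s := if t ∈ s then gsign R t s * f (s.erase t) else 0
  map_add' f g := by
    ext s
    simp only [Pi.add_apply]
    split_ifs <;> ring
  map_smul' c f := by
    ext s
    simp only [Pi.smul_apply, smul_eq_mul, RingHom.id_apply]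
    split_ifs <;> ring

theorem pderivL_apply (t : Fin N) (f : Gr R N) (s : Finset (Fin N)) :
    pderivL t f s = if t ∈ s then 0 else gsign R t s * f (insert t s) := rfl

theorem genMul_apply (t : Fin N) (f : Gr R N) (s : Finset (Fin N)) :
    genMul t f s = if t ∈ s then gsign R t s * f (s.erase t) else 0 := rfl

theorem lt_sign_antisymm {t u : Fin N} (h : t ≠ u) :
    (if u < t then -1 else 1 : R) = -(if t < u then -1 else 1) := by
  rcases lt_or_gt_of_ne h with h | h <;> simp [h, h.not_gt]

theorem genMul_genMul (t u : Fin N) (f : Gr R N) :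
    genMul t (genMul u f) = -genMul u (genMul t f) := by
  ext s
  rw [Pi.neg_apply]
  simp only [genMul_apply]
  by_cases h : t = u
  · simp [h]
  by_cases ht : t ∈ s <;> by_cases hu : u ∈ s <;> simp [ht, hu, h, Ne.symm h]
  rw [gsign_erase ht, gsign_erase hu, lt_sign_antisymm h, erase_right_comm]
  ring

theorem pderivL_pderivL (t u : Fin N) (f : Gr R N) :
    pderivL t (pderivL u f) = -pderivL u (pderivL t f) := by
  ext s
  rw [Pi.neg_apply]
  simp only [pderivL_apply]
  by_cases h : t = u
  · simp [h]
  by_cases ht : t ∈ s <;> by_cases hu : u ∈ s <;> simp [ht, hu, h, Ne.symm h]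
  rw [gsign_insert ht, gsign_insert hu, lt_sign_antisymm h, insert_comm]
  ring

theorem pderivL_genMul (t u : Fin N) (f : Gr R N) :
    pderivL t (genMul u f) = (if t = u then (1 : R) else 0) • f - genMul u (pderivL t f) := by
  ext s
  simp only [Pi.sub_apply, Pi.smul_apply, smul_eq_mul, pderivL_apply, genMul_apply]
  by_cases h : t = u
  · subst h
    by_cases ht : t ∈ s
    · simp [ht, gsign_erase_self, ← mul_assoc, gsign_mul_self]
    · simp [ht, gsign_insert_self, ← mul_assoc, gsign_mul_self]
  by_cases ht : t ∈ s <;> by_cases hu : u ∈ s <;> simp [ht, hu, h, Ne.symm h]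
  rw [gsign_insert ht, gsign_erase hu, lt_sign_antisymm h, erase_insert_of_ne h]
  ring

theorem genMul_pderivL (t u : Fin N) (f : Gr R N) :
    genMul t (pderivL u f) = (if t = u then (1 : R) else 0) • f - pderivL u (genMul t f) := by
  rw [pderivL_genMul]
  simp [eq_comm]

theorem mul_genMul (t : Fin N) (f g : Gr R N) : mul (genMul t f) g = genMul t (mul f g) := by
  ext s
  rw [genMul_apply]
  split_ifs with ht
  · obtain ⟨s, hs, rfl⟩ : ∃ s', t ∉ s' ∧ insert t s' = s :=
      ⟨s.erase t, notMem_erase t s, insert_erase ht⟩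
    rw [erase_insert hs, mul, sum_powerset_insert hs, mul, mul_sum, sum_eq_zero, zero_add]
    · refine sum_congr rfl fun A hA => ?_
      rw [mem_powerset] at hA
      have htA : t ∉ A := fun h => hs (hA h)
      have hsd : insert t s \ insert t A = s \ A := by
        ext i
        simp only [mem_sdiff, mem_insert]
        grind
      have hsign : msign (R := R) (insert t A) (s \ A) * gsign R t A
          = gsign R t s * msign A (s \ A) := by
        have h1 : ((insert t A) ×ˢ (s \ A)).filter (fun p => p.2 < p.1)
            = (((s \ A).filter fun i => i < t).image fun i => (t, i))
              ∪ (A ×ˢ (s \ A)).filter (fun p => p.2 < p.1) := by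
          ext ⟨a, b⟩
          simp only [mem_filter, mem_product, mem_insert, mem_union, mem_image, mem_sdiff,
            Prod.mk.injEq]
          grind
        have h2 : Disjoint
            (((s \ A).filter fun i => i < t).image fun i => (t, i))
            ((A ×ˢ (s \ A)).filter (fun p => p.2 < p.1)) := by
          rw [disjoint_left]
          rintro ⟨a, b⟩ h h'
          simp only [mem_filter, mem_product, mem_image, mem_sdiff,
            Prod.mk.injEq] at h h'
          grind
        have h3 : s.filter (fun i => i < t)
            = (s \ A).filter (fun i => i < t) ∪ A.filter (fun i => i < t) := by
          rw [← filter_union, sdiff_union_of_subset hA]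
        have h4 : Disjoint ((s \ A).filter (fun i => i < t)) (A.filter (fun i => i < t)) :=
          disjoint_filter_filter sdiff_disjoint
        rw [msign, h1, card_union_of_disjoint h2,
          card_image_of_injective _ (Prod.mk_right_injective t), gsign, gsign, h3,
          card_union_of_disjoint h4, msign]
        ring
      rw [genMul_apply, if_pos (mem_insert_self t A), erase_insert htA, hsd, gsign_insert_self,
        gsign_insert_self, ← mul_assoc, hsign, ← mul_assoc, ← mul_assoc]
    · intro A hA
      rw [genMul_apply, if_neg fun h => hs (mem_powerset.1 hA h)]
      simp
  · refine sum_eq_zero fun A hA => ?_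
    rw [genMul_apply, if_neg fun h => ht (mem_powerset.1 hA h)]
    simp

theorem one_mul_eq (g : Gr R N) : mul one g = g := by
  ext s
  rw [mul, sum_eq_single ∅]
  · simp [one, msign]
  · intro A _ hA
    simp [one, hA]
  · simp

theorem genMul_one (t : Fin N) : genMul t (one : Gr R N) = gen t := by
  ext s
  simp only [genMul_apply, one, gen]
  by_cases h : s = {t}
  · simp [h, gsign, filter_singleton]
  · have h' : t ∈ s → s.erase t ≠ ∅ := fun ht he => h (by rw [← insert_erase ht, he]; rfl)
    by_cases ht : t ∈ s <;> simp_all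

theorem gen_mul (t : Fin N) (g : Gr R N) : mul (gen t) g = genMul t g := by
  rw [← genMul_one, mul_genMul, one_mul_eq]

/-- Right multiplication by `g` as a linear map. -/
def mulRight (g : Gr R N) : Module.End R (Gr R N) where
  toFun f := mul f g
  map_add' f f' := by
    ext s
    simp only [mul, Pi.add_apply, ← sum_add_distrib]
    exact sum_congr rfl fun _ _ => by ring
  map_smul' c f := by
    ext s
    simp only [mul, Pi.smul_apply, smul_eq_mul, RingHom.id_apply, mul_sum]
    exact sum_congr rfl fun _ _ => by ring

theorem mulRight_one (g : Gr R N) : mulRight g one = g := one_mul_eq g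

theorem mulRight_genMul (t : Fin N) (f g : Gr R N) :
    mulRight g (genMul t f) = genMul t (mulRight g f) := mul_genMul t f g

theorem foldr_genMul_one {l : List (Fin N)} (hl : l.Pairwise (· < ·)) :
    l.foldr (fun t f => genMul t f) (one : Gr R N) = Pi.single l.toFinset 1 := by
  induction l with
  | nil =>
    ext s
    simp [one, Pi.single_apply]
  | cons t l ih =>
    rw [List.pairwise_cons] at hl
    rw [List.foldr_cons, ih hl.2]
    have htl : t ∉ l.toFinset := by
      rw [List.mem_toFinset]
      exact fun h => lt_irrefl _ (hl.1 t h)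
    ext s
    rw [genMul_apply, List.toFinset_cons, Pi.single_apply, Pi.single_apply]
    by_cases hs : s = insert t l.toFinset
    · subst hs
      have h0 : l.toFinset.filter (fun i => i < t) = ∅ := by
        rw [filter_eq_empty_iff]
        intro i hi
        exact (hl.1 i (List.mem_toFinset.1 hi)).not_gt
      rw [if_pos (mem_insert_self _ _), erase_insert htl, gsign_insert_self, gsign, h0]
      simp
    · rw [if_neg hs]
      split_ifs with h1 h2
      · exact absurd (by rw [← h2, insert_erase h1]) hs
      · simp
      · rfl

theorem foldr_genMul_sort (A : Finset (Fin N)) :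
    (A.sort (· ≤ ·)).foldr (fun t f => genMul t f) (one : Gr R N) = Pi.single A 1 := by
  rw [foldr_genMul_one (Finset.sortedLT_sort A).pairwise, sort_toFinset]

theorem linearMap_ext {S T : Module.End R (Gr R N)} (h1 : S one = T one)
    (h : ∀ t f, S f = T f → S (genMul t f) = T (genMul t f)) : S = T := by
  refine LinearMap.pi_ext' fun A => LinearMap.ext_ring ?_
  simp only [LinearMap.coe_comp, Function.comp_apply, LinearMap.coe_single]
  rw [← foldr_genMul_sort]
  induction A.sort (· ≤ ·) with
  | nil => exact h1
  | cons t l ih => exact h t _ ih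

/-- The quadratic operator `∑_j a_{2j-1} a_{2j}` built from a family of operators. -/
def quad {n : ℕ} (a : Fin (2 * n) → Module.End R (Gr R (2 * n))) : Module.End R (Gr R (2 * n)) :=
  ∑ j : Fin n, a (lo n j) * a (hi n j)

theorem quad_apply {n : ℕ} (a : Fin (2 * n) → Module.End R (Gr R (2 * n))) (f : Gr R (2 * n)) :
    quad a f = ∑ j : Fin n, a (lo n j) (a (hi n j) f) := by
  simp [quad, LinearMap.sum_apply]

theorem apply_quad {n : ℕ} {a : Fin (2 * n) → Module.End R (Gr R (2 * n))}
    {b : Module.End R (Gr R (2 * n))} {c : Fin (2 * n) → R}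
    (h : ∀ u f, b (a u f) = c u • f - a u (b f)) (f : Gr R (2 * n)) :
    b (quad a f) = quad a (b f) + ∑ j : Fin n,
      (c (lo n j) • a (hi n j) f - c (hi n j) • a (lo n j) f) := by
  simp only [quad_apply, map_sum, h, map_sub, map_smul, ← sum_add_distrib]
  exact sum_congr rfl fun j _ => by abel

theorem lo_ne_hi (n : ℕ) (j k : Fin n) : lo n j ≠ hi n k := by
  simp only [lo, hi, ne_eq, Fin.mk.injEq]
  omega

theorem lo_inj {n : ℕ} {j k : Fin n} : lo n j = lo n k ↔ j = k := by
  simp only [lo, Fin.ext_iff]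
  omega

theorem hi_inj {n : ℕ} {j k : Fin n} : hi n j = hi n k ↔ j = k := by
  simp only [hi, Fin.ext_iff]
  omega

theorem eq_lo_or_hi {n : ℕ} (t : Fin (2 * n)) : (∃ j, t = lo n j) ∨ ∃ j, t = hi n j := by
  rcases Nat.mod_two_eq_zero_or_one t with h | h
  · exact Or.inl ⟨⟨t / 2, by omega⟩, by simp only [lo, Fin.ext_iff]; omega⟩
  · exact Or.inr ⟨⟨t / 2, by omega⟩, by simp only [hi, Fin.ext_iff]; omega⟩

theorem lo_apply_quad {n : ℕ} {a : Fin (2 * n) → Module.End R (Gr R (2 * n))}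
    {b : Fin (2 * n) → Module.End R (Gr R (2 * n))}
    (h : ∀ t u f, b t (a u f) = (if t = u then (1 : R) else 0) • f - a u (b t f))
    (j : Fin n) (f : Gr R (2 * n)) :
    b (lo n j) (quad a f) = quad a (b (lo n j) f) + a (hi n j) f := by
  rw [apply_quad (h (lo n j))]
  simp [lo_ne_hi, lo_inj]

theorem hi_apply_quad {n : ℕ} {a : Fin (2 * n) → Module.End R (Gr R (2 * n))}
    {b : Fin (2 * n) → Module.End R (Gr R (2 * n))}
    (h : ∀ t u f, b t (a u f) = (if t = u then (1 : R) else 0) • f - a u (b t f))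
    (j : Fin n) (f : Gr R (2 * n)) :
    b (hi n j) (quad a f) = quad a (b (hi n j) f) - a (lo n j) f := by
  rw [apply_quad (h (hi n j))]
  simp [(lo_ne_hi n _ _).symm, hi_inj, sub_eq_add_neg]

theorem apply_quad_of_anticomm {n : ℕ} {a : Fin (2 * n) → Module.End R (Gr R (2 * n))}
    (h : ∀ t u f, a t (a u f) = -a u (a t f)) (t : Fin (2 * n)) (f : Gr R (2 * n)) :
    a t (quad a f) = quad a (a t f) := by
  rw [apply_quad (c := 0) (fun u f => by simp [h t u f])]
  simp

/-- The operator substituted for the generator `t`, over an arbitrary coefficient ring: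
`x`_{2j-1} → -2 ∂_{x`_{2j}}` and `x`_{2j} → 2 ∂_{x`_{2j-1}}`. -/
def dualDeriv {n : ℕ} (t : Fin (2 * n)) : Module.End R (Gr R (2 * n)) :=
  if h : (t : ℕ) % 2 = 0 then
    (-2 : R) • pderivL ⟨(t : ℕ) + 1, by have := t.isLt; omega⟩
  else
    (2 : R) • pderivL ⟨(t : ℕ) - 1, by have := t.isLt; omega⟩

theorem dualDeriv_lo {n : ℕ} (j : Fin n) :
    dualDeriv (R := R) (lo n j) = (-2 : R) • pderivL (hi n j) := by
  simp [dualDeriv, lo, hi]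

theorem dualDeriv_hi {n : ℕ} (j : Fin n) :
    dualDeriv (R := R) (hi n j) = (2 : R) • pderivL (lo n j) := by
  simp [dualDeriv, lo, hi, Nat.add_mod]

theorem Dop_eq_dualDeriv {n : ℕ} (t : Fin (2 * n)) (g : Gr ℂ (2 * n)) :
    Dop n t g = dualDeriv t g := by
  unfold Dop dualDeriv
  split_ifs <;> rfl

theorem exists_dualDeriv_eq_smul {n : ℕ} (t : Fin (2 * n)) :
    ∃ (c : R) (u : Fin (2 * n)), dualDeriv (R := R) t = c • pderivL u := by
  obtain ⟨j, rfl⟩ | ⟨j, rfl⟩ := eq_lo_or_hi t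
  exacts [⟨_, _, dualDeriv_lo j⟩, ⟨_, _, dualDeriv_hi j⟩]

theorem quad_genMul_dualDeriv {n : ℕ} (t : Fin (2 * n)) (f : Gr R (2 * n)) :
    quad genMul (dualDeriv t f) = dualDeriv t (quad genMul f) - (2 : R) • genMul t f := by
  obtain ⟨j, rfl⟩ | ⟨j, rfl⟩ := eq_lo_or_hi t
  · rw [dualDeriv_lo, LinearMap.smul_apply, LinearMap.smul_apply, hi_apply_quad pderivL_genMul,
      map_smul]
    module
  · rw [dualDeriv_hi, LinearMap.smul_apply, LinearMap.smul_apply, lo_apply_quad pderivL_genMul,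
      map_smul]
    module

theorem quad_pderivL_genMul {n : ℕ} (t : Fin (2 * n)) (f : Gr R (2 * n)) :
    (4 : R) • quad pderivL (genMul t f)
      = genMul t ((4 : R) • quad pderivL f) + (2 : R) • dualDeriv t f := by
  obtain ⟨j, rfl⟩ | ⟨j, rfl⟩ := eq_lo_or_hi t
  · rw [dualDeriv_lo, LinearMap.smul_apply, map_smul, lo_apply_quad genMul_pderivL]
    module
  · rw [dualDeriv_hi, LinearMap.smul_apply, map_smul, hi_apply_quad genMul_pderivL]
    module

theorem quad_pderivL_dualDeriv {n : ℕ} (t : Fin (2 * n)) (f : Gr R (2 * n)) :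
    quad pderivL (dualDeriv t f) = dualDeriv t (quad pderivL f) := by
  obtain ⟨c, u, h⟩ := exists_dualDeriv_eq_smul (R := R) t
  rw [h, LinearMap.smul_apply, LinearMap.smul_apply, map_smul,
    apply_quad_of_anticomm pderivL_pderivL]

/-- If multiplication by every generator acts on `g` as the operator substituted for it, the
substituted operators act on multiples of `g` through the shifted operators. -/
theorem dualDeriv_mulRight {n : ℕ} {g : Gr R (2 * n)} (t : Fin (2 * n))
    (hg : dualDeriv t g = genMul t g) (f : Gr R (2 * n)) :
    dualDeriv t (mulRight g f) = mulRight g (genMul t f + dualDeriv t f) := by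
  obtain ⟨c, u, hu⟩ := exists_dualDeriv_eq_smul (R := R) t
  suffices h : dualDeriv t * mulRight g = mulRight g * (genMul t + dualDeriv t) from
    congrArg (fun S : Module.End R (Gr R (2 * n)) => S f) h
  refine linearMap_ext ?_ fun v f ih => ?_
  · have h0 : pderivL u (one : Gr R (2 * n)) = 0 := by
      ext s
      simp [pderivL_apply, one]
    have h1 : dualDeriv t (one : Gr R (2 * n)) = 0 := by simp [hu, h0]
    simp [mulRight_one, hg, mulRight_genMul, h1]
  · simp only [Module.End.mul_apply, LinearMap.add_apply, map_add, mulRight_genMul] at ih ⊢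
    have key : ∀ f : Gr R (2 * n), dualDeriv t (genMul v f)
        = (c * if u = v then (1 : R) else 0) • f - genMul v (dualDeriv t f) := by
      intro f
      simp only [hu, LinearMap.smul_apply, pderivL_genMul, map_smul, smul_sub, mul_smul]
    rw [key, key, ih, map_sub, map_smul, mulRight_genMul, map_add, genMul_genMul t v]
    abel

theorem genMul_apply_eq_zero {k : ℕ} {f : Gr R N} (hf : ∀ s, s.card ≠ k → f s = 0) (t : Fin N)
    {s : Finset (Fin N)} (hs : s.card ≠ k + 1) : genMul t f s = 0 := by
  rw [genMul_apply]
  split_ifs with ht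
  · rw [hf, mul_zero]
    rw [card_erase_of_mem ht]
    have := card_pos.2 ⟨t, ht⟩
    omega
  · rfl

theorem quad_genMul_pow_one_apply {n : ℕ} (k : ℕ) (s : Finset (Fin (2 * n)))
    (hs : s.card ≠ 2 * k) : (quad genMul ^ k) (one : Gr R (2 * n)) s = 0 := by
  induction k generalizing s with
  | zero =>
    have hs' : s ≠ ∅ := by simpa using hs
    simp [one, hs']
  | succ k ih =>
    rw [pow_succ', Module.End.mul_apply, quad_apply, Finset.sum_apply]
    refine sum_eq_zero fun j _ => ?_
    exact genMul_apply_eq_zero (fun s hs => genMul_apply_eq_zero ih _ hs) _ hs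

theorem pow_xsq (n k : ℕ) : pow (xsq n) k = (quad genMul ^ k) one := by
  have hx : xsq n = quad genMul one := by
    simp only [xsq, quad_apply, gen_mul, genMul_one]
  have hm : ∀ (k : ℕ) (f g : Gr ℂ (2 * n)),
      mulRight g ((quad genMul ^ k) f) = (quad genMul ^ k) (mulRight g f) := by
    intro k
    induction k with
    | zero => simp
    | succ k ih =>
      intro f g
      simp only [pow_succ', Module.End.mul_apply, quad_apply, map_sum, mulRight_genMul, ih]
  induction k with
  | zero => rfl
  | succ k ih =>
    change mulRight (xsq n) (pow (xsq n) k) = _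
    rw [ih, hm, mulRight_one, hx, pow_succ, Module.End.mul_apply]

theorem dualDeriv_fermGauss {n : ℕ} (t : Fin (2 * n)) :
    dualDeriv t (fermGauss n) = genMul t (fermGauss n) := by
  have hG : fermGauss n = truncExp (quad genMul) (n + 1) one := by
    simp [fermGauss, truncExp, LinearMap.sum_apply, pow_xsq]
  have h := truncExp_succ_mul (Δ := quad genMul) (X := dualDeriv (R := ℂ) t) (C := -genMul t)
    (LinearMap.ext fun f => by
      simp [quad_genMul_dualDeriv, sub_eq_add_neg])
    (LinearMap.ext fun f => by
      simp [apply_quad_of_anticomm genMul_genMul]) n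
  have h1 := congrArg (fun S : Module.End ℂ (Gr ℂ (2 * n)) => S one) h
  obtain ⟨c, u, hu⟩ := exists_dualDeriv_eq_smul (R := ℂ) t
  have h0 : dualDeriv t (one : Gr ℂ (2 * n)) = 0 := by
    ext s
    simp [hu, pderivL_apply, one]
  have htop : genMul t ((quad genMul ^ n) (one : Gr ℂ (2 * n))) = 0 := by
    ext s
    refine genMul_apply_eq_zero (quad_genMul_pow_one_apply n) t ?_
    have := card_le_univ s
    rw [Fintype.card_fin] at this
    omega
  simp only [Module.End.mul_apply, LinearMap.add_apply, LinearMap.neg_apply, h0, map_zero,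
    ← hG] at h1
  rw [eq_comm, add_neg_eq_zero] at h1
  rw [h1, hG]
  simp [truncExp, sum_range_succ, htop]

end Gr

namespace Gr

variable {R S : Type} [CommRing R] [CommRing S] {N : ℕ}

theorem map_gsign_mul (φ : R →+ S) (t : Fin N) (s : Finset (Fin N)) (r : R) :
    φ (gsign R t s * r) = gsign S t s * φ r := by
  unfold gsign
  obtain h | h := Nat.even_or_odd (s.filter fun i => i < t).card <;> simp [h.neg_one_pow]

theorem pderivL_map (φ : R →+ S) (t : Fin N) (f : Gr R N) :
    (pderivL t fun s => φ (f s)) = fun s => φ (pderivL t f s) := by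
  ext s
  simp only [pderivL_apply]
  split_ifs
  · simp
  · rw [map_gsign_mul]

theorem genMul_map (φ : R →+ S) (t : Fin N) (f : Gr R N) :
    (genMul t fun s => φ (f s)) = fun s => φ (genMul t f s) := by
  ext s
  simp only [genMul_apply]
  split_ifs
  · rw [map_gsign_mul]
  · simp

theorem dualDeriv_map {n : ℕ} (φ : R →+ S) (t : Fin (2 * n)) (f : Gr R (2 * n)) :
    (dualDeriv t fun s => φ (f s)) = fun s => φ (dualDeriv t f s) := by
  have h2 : ∀ r : R, φ (2 * r) = 2 * φ r := fun r => by simp [two_mul]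
  obtain ⟨j, rfl⟩ | ⟨j, rfl⟩ := eq_lo_or_hi t
  · ext s
    simp [dualDeriv_lo, pderivL_map, h2]
  · ext s
    simp [dualDeriv_hi, pderivL_map, h2]

theorem quad_pderivL_map {n : ℕ} (φ : R →+ S) (f : Gr R (2 * n)) :
    (quad pderivL fun s => φ (f s)) = fun s => φ (quad pderivL f s) := by
  simp only [quad_apply, pderivL_map]
  ext s
  simp [Finset.sum_apply]

theorem msign_mul_map (φ : R →+* S) (A B : Finset (Fin N)) :
    φ (msign A B) = msign A B := by
  simp [msign]

end Gr

open Gr MvPolynomial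

section SuperOperators

variable {m n : ℕ}

/-- Coefficientwise partial derivative with respect to a commuting variable. -/
def coeffDeriv (i : Fin m) : Module.End ℂ (PG m n) :=
  (MvPolynomial.pderiv i).toLinearMap.compLeft _

/-- Coefficientwise multiplication by a commuting variable. -/
def coeffMul (i : Fin m) : Module.End ℂ (PG m n) :=
  (LinearMap.mulLeft ℂ (X i)).compLeft _

theorem coeffDeriv_apply (i : Fin m) (P : PG m n) :
    coeffDeriv i P = fun s => MvPolynomial.pderiv i (P s) := rfl

theorem coeffMul_apply (i : Fin m) (P : PG m n) : coeffMul i P = fun s => X i * P s := rfl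

/-- The super Laplace operator on `ℂ[x_1,…,x_m] ⊗ Λ_{2n}` as a linear map. -/
def superLapL (m n : ℕ) : Module.End ℂ (PG m n) :=
  ((4 : MvPolynomial (Fin m) ℂ) • quad pderivL).restrictScalars ℂ
    - ∑ i : Fin m, coeffDeriv i * coeffDeriv i

theorem superLapL_apply (P : PG m n) :
    superLapL m n P = (4 : MvPolynomial (Fin m) ℂ) • quad pderivL P
      - ∑ i : Fin m, coeffDeriv i (coeffDeriv i P) := by
  simp [superLapL, LinearMap.sum_apply]

theorem superLapL_eq_superLapP (P : PG m n) : superLapL m n P = superLapP m n P := by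
  ext1 s
  rw [superLapL_apply, Pi.sub_apply, Pi.smul_apply, quad_apply, Finset.sum_apply,
    Finset.sum_apply]
  rfl

theorem pderiv_pderiv_comm (i j : Fin m) (p : MvPolynomial (Fin m) ℂ) :
    MvPolynomial.pderiv i (MvPolynomial.pderiv j p)
      = MvPolynomial.pderiv j (MvPolynomial.pderiv i p) := by
  have h : ⁅(MvPolynomial.pderiv i : Derivation ℂ (MvPolynomial (Fin m) ℂ) _),
      (MvPolynomial.pderiv j : Derivation ℂ (MvPolynomial (Fin m) ℂ) _)⁆ = 0 := by
    classical
    refine derivation_ext fun k => ?_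
    simp [Derivation.commutator_apply, pderiv_X, Pi.single_apply, apply_ite]
  have h' := congrArg
    (fun D : Derivation ℂ (MvPolynomial (Fin m) ℂ) (MvPolynomial (Fin m) ℂ) => D p) h
  simpa [Derivation.commutator_apply, sub_eq_zero] using h'

theorem coeffDeriv_comm (i j : Fin m) (P : PG m n) :
    coeffDeriv i (coeffDeriv j P) = coeffDeriv j (coeffDeriv i P) :=
  funext fun s => pderiv_pderiv_comm i j (P s)

theorem coeffDeriv_coeffMul (i j : Fin m) (P : PG m n) :
    coeffDeriv i (coeffMul j P)
      = coeffMul j (coeffDeriv i P) + (if i = j then (1 : ℂ) else 0) • P := by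
  ext1 s
  simp only [coeffDeriv_apply, coeffMul_apply, Pi.add_apply, Pi.smul_apply, Derivation.leibniz,
    pderiv_X, smul_eq_mul, Pi.single_apply]
  by_cases h : i = j
  · simp [h]
  · simp [h, Ne.symm h]

theorem superLapL_mul_coeffMul (i : Fin m) :
    superLapL m n * coeffMul i = coeffMul i * superLapL m n + (2 : ℂ) • (-coeffDeriv i) := by
  refine LinearMap.ext fun P => ?_
  have hq : quad pderivL (coeffMul i P) = coeffMul i (quad pderivL P) :=
    quad_pderivL_map (LinearMap.mulLeft ℂ (X i)).toAddMonoidHom P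
  have h4 : coeffMul i ((4 : MvPolynomial (Fin m) ℂ) • quad pderivL P)
      = (4 : MvPolynomial (Fin m) ℂ) • coeffMul i (quad pderivL P) := by
    ext1 s
    simp only [coeffMul_apply, Pi.smul_apply, smul_eq_mul]
    ring
  simp only [Module.End.mul_apply, LinearMap.add_apply, LinearMap.smul_apply, LinearMap.neg_apply,
    superLapL_apply, map_sub, map_sum, hq, h4, coeffDeriv_coeffMul, map_add, map_smul,
    sum_add_distrib]
  simp only [ite_smul, one_smul, zero_smul, sum_ite_eq', mem_univ, if_true, two_smul]
  abel

theorem superLapL_mul_coeffDeriv (i : Fin m) :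
    superLapL m n * coeffDeriv i = coeffDeriv i * superLapL m n := by
  refine LinearMap.ext fun P => ?_
  have hq : quad pderivL (coeffDeriv i P) = coeffDeriv i (quad pderivL P) :=
    quad_pderivL_map (MvPolynomial.pderiv i).toLinearMap.toAddMonoidHom P
  have h4 : coeffDeriv i ((4 : MvPolynomial (Fin m) ℂ) • quad pderivL P)
      = (4 : MvPolynomial (Fin m) ℂ) • coeffDeriv i (quad pderivL P) := by
    ext1 s
    have h : (4 : MvPolynomial (Fin m) ℂ) = C 4 := (map_ofNat C 4).symm
    simp only [coeffDeriv_apply, Pi.smul_apply, smul_eq_mul, h, pderiv_C_mul]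
  simp only [Module.End.mul_apply, superLapL_apply, map_sub, map_sum, hq, h4,
    coeffDeriv_comm i]

/-- Left multiplication by an anticommuting generator as a `ℂ`-linear map. -/
def genMulC (t : Fin (2 * n)) : Module.End ℂ (PG m n) := (genMul t).restrictScalars ℂ

/-- The substituted odd operator as a `ℂ`-linear map. -/
def dualDerivC (t : Fin (2 * n)) : Module.End ℂ (PG m n) := (dualDeriv t).restrictScalars ℂ

theorem superLapL_mul_genMulC (t : Fin (2 * n)) :
    superLapL m n * genMulC t = genMulC t * superLapL m n + (2 : ℂ) • dualDerivC t := by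
  refine LinearMap.ext fun P => ?_
  have hd : ∀ (i : Fin m) (P : PG m n), coeffDeriv i (genMul t P) = genMul t (coeffDeriv i P) :=
    fun i P => (genMul_map (MvPolynomial.pderiv i).toLinearMap.toAddMonoidHom t P).symm
  have h2 : (2 : MvPolynomial (Fin m) ℂ) • dualDeriv t P = (2 : ℂ) • dualDeriv t P := by
    rw [two_smul, two_smul]
  simp only [Module.End.mul_apply, LinearMap.add_apply, LinearMap.smul_apply, genMulC, dualDerivC,
    LinearMap.restrictScalars_apply, superLapL_apply, quad_pderivL_genMul, map_sub, map_sum, hd, h2]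
  abel

theorem superLapL_mul_dualDerivC (t : Fin (2 * n)) :
    superLapL m n * dualDerivC t = dualDerivC t * superLapL m n := by
  refine LinearMap.ext fun P => ?_
  have hd : ∀ (i : Fin m) (P : PG m n),
      coeffDeriv i (dualDeriv t P) = dualDeriv t (coeffDeriv i P) :=
    fun i P => (dualDeriv_map (MvPolynomial.pderiv i).toLinearMap.toAddMonoidHom t P).symm
  simp only [Module.End.mul_apply, dualDerivC, LinearMap.restrictScalars_apply, superLapL_apply,
    quad_pderivL_dualDeriv, map_sub, map_sum, map_smul, hd]

/-- The fermionic Gaussian with constant polynomial coefficients. -/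
def fermGaussP (m n : ℕ) : PG m n := fun s => C (fermGauss n s)

/-- Multiplication of a polynomial by the commuting Gaussian, as a function on `ℝ^m`. -/
def bosGaussMul (m n : ℕ) : PG m n →ₗ[ℂ] SF m n where
  toFun P x s := ((Real.exp (-(∑ i : Fin m, (x i) ^ 2) / 2) : ℝ) : ℂ) *
    eval (fun i => ((x i : ℝ) : ℂ)) (P s)
  map_add' P Q := by
    ext x s
    simp [mul_add]
  map_smul' c P := by
    ext x s
    simp [smul_eval]
    ring

/-- Multiplication of a polynomial by the super Gaussian. -/
def superGaussMul (m n : ℕ) : PG m n →ₗ[ℂ] SF m n :=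
  bosGaussMul m n ∘ₗ (mulRight (fermGaussP m n)).restrictScalars ℂ

theorem superGaussMul_apply (P : PG m n) :
    superGaussMul m n P = bosGaussMul m n (mulRight (fermGaussP m n) P) := rfl

theorem superGaussMul_eq_mul (P : PG m n) :
    superGaussMul m n P = fun x => Gr.mul (evalP m n P x) (gaussFun m n x) := by
  ext x s
  simp only [superGaussMul_apply, bosGaussMul, LinearMap.coe_mk, AddHom.coe_mk, mulRight, Gr.mul,
    map_sum, map_mul, msign_mul_map, fermGaussP, eval_C, evalP, gaussFun, mul_sum, Pi.smul_apply,
    smul_eq_mul]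
  exact sum_congr rfl fun _ _ => by ring

theorem superGaussMul_one : superGaussMul m n one = gaussFun m n := by
  rw [superGaussMul_apply, mulRight_one]
  ext x s
  simp [bosGaussMul, fermGaussP, gaussFun]

theorem exists_hasFDerivAt_eval (p : MvPolynomial (Fin m) ℂ) (x : Fin m → ℝ) :
    ∃ f' : (Fin m → ℝ) →L[ℝ] ℂ,
      HasFDerivAt (fun y : Fin m → ℝ => eval (fun i => ((y i : ℝ) : ℂ)) p) f' x ∧
      ∀ i, f' (Pi.single i 1) = eval (fun i => ((x i : ℝ) : ℂ)) (MvPolynomial.pderiv i p) := by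
  induction p using MvPolynomial.induction_on with
  | C a => exact ⟨0, by simpa using hasFDerivAt_const a x, by simp⟩
  | add p q hp hq =>
    obtain ⟨p', hp, hp'⟩ := hp
    obtain ⟨q', hq, hq'⟩ := hq
    exact ⟨p' + q', by simpa using hp.fun_add hq, by simp [hp', hq']⟩
  | mul_X p j hp =>
    obtain ⟨p', hp, hp'⟩ := hp
    have hX : HasFDerivAt (fun y : Fin m → ℝ => ((y j : ℝ) : ℂ))
        (Complex.ofRealCLM ∘L ContinuousLinearMap.proj j) x :=
      (Complex.ofRealCLM ∘L ContinuousLinearMap.proj (R := ℝ) (φ := fun _ : Fin m => ℝ) j).hasFDerivAt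
    refine ⟨_, by simpa using hp.fun_mul hX, fun i => ?_⟩
    by_cases h : i = j
    · subst h
      simp [hp', pderiv_X]
    · simp [hp', pderiv_X, Ne.symm h]

theorem bosD_bosGaussMul (i : Fin m) (P : PG m n) :
    bosD m n i (bosGaussMul m n P) = bosGaussMul m n (coeffMul i P - coeffDeriv i P) := by
  ext x s
  obtain ⟨f', hf, hf'⟩ := exists_hasFDerivAt_eval (P s) x
  have hsq : HasFDerivAt (fun y : Fin m → ℝ => -(∑ i : Fin m, (y i) ^ 2) / 2)
      (-∑ i : Fin m, x i • ContinuousLinearMap.proj (R := ℝ) (φ := fun _ : Fin m => ℝ) i) x := by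
    have h : ∀ i ∈ (univ : Finset (Fin m)), HasFDerivAt (fun y : Fin m → ℝ => (y i) ^ 2)
        ((2 * x i) • ContinuousLinearMap.proj (R := ℝ) (φ := fun _ : Fin m => ℝ) i) x := by
      intro i _
      simpa using (ContinuousLinearMap.proj (R := ℝ) (φ := fun _ : Fin m => ℝ) i).hasFDerivAt
        (x := x) |>.pow 2
    have h2 := ((HasFDerivAt.fun_sum h).neg).mul_const (2⁻¹ : ℝ)
    simp only [div_eq_mul_inv]
    refine h2.congr_fderiv ?_
    ext v
    simp [mul_sum, mul_assoc]
  have hexp := Complex.ofRealCLM.hasFDerivAt.comp x hsq.exp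
  have hmul := hexp.fun_mul hf
  have hfun : (fun y => bosGaussMul m n P y s) = (fun y : Fin m → ℝ =>
      (Complex.ofRealCLM ∘ fun y => Real.exp (-(∑ i : Fin m, (y i) ^ 2) / 2)) y *
        eval (fun i => ((y i : ℝ) : ℂ)) (P s)) := rfl
  rw [bosD, hfun, HasFDerivAt.fderiv hmul]
  simp [hf', bosGaussMul, coeffMul_apply, coeffDeriv_apply, Pi.single_apply, mul_sub]
  ring

theorem bosD_superGaussMul (i : Fin m) (P : PG m n) :
    bosD m n i (superGaussMul m n P)
      = superGaussMul m n (coeffMul i P + (-coeffDeriv i) P) := by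
  rw [superGaussMul_apply, bosD_bosGaussMul, superGaussMul_apply]
  congr 1
  ext1 s
  simp only [Pi.sub_apply, coeffMul_apply, coeffDeriv_apply, mulRight, LinearMap.coe_mk,
    AddHom.coe_mk, Gr.mul, mul_sum, map_sum, ← sum_sub_distrib]
  refine sum_congr rfl fun A _ => ?_
  have hs : MvPolynomial.pderiv i (msign A (s \ A) : MvPolynomial (Fin m) ℂ) = 0 := by
    rw [← msign_mul_map (C : ℂ →+* MvPolynomial (Fin m) ℂ), pderiv_C]
  simp only [fermGaussP, Derivation.leibniz, hs, pderiv_C, smul_eq_mul, Pi.add_apply,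
    LinearMap.neg_apply, Pi.neg_apply, coeffDeriv_apply]
  ring

theorem Dop_superGaussMul (t : Fin (2 * n)) (P : PG m n) :
    (fun x => Dop n t (superGaussMul m n P x))
      = superGaussMul m n (genMulC t P + dualDerivC t P) := by
  have hg : dualDeriv t (fermGaussP m n) = genMul t (fermGaussP m n) := by
    have hd := dualDeriv_map (C : ℂ →+* MvPolynomial (Fin m) ℂ).toAddMonoidHom t (fermGauss n)
    have hm := genMul_map (C : ℂ →+* MvPolynomial (Fin m) ℂ).toAddMonoidHom t (fermGauss n)
    rw [dualDeriv_fermGauss, ← hm] at hd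
    exact hd
  rw [superGaussMul_apply, superGaussMul_apply]
  refine Eq.trans ?_ (congrArg (bosGaussMul m n) (dualDeriv_mulRight t hg P))
  ext1 x
  rw [Dop_eq_dualDeriv]
  exact dualDeriv_map ((AddMonoidHom.mulLeft
    ((Real.exp (-(∑ i : Fin m, (x i) ^ 2) / 2) : ℝ) : ℂ)).comp
      (eval fun i => ((x i : ℝ) : ℂ)).toAddMonoidHom) t _

/-- `F` is the product of `exp(Δ/2) P` with the super Gaussian, the exponential series being
finite on `P`. -/
def IsGaussTransform (F : SF m n) (P : PG m n) : Prop :=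
  ∃ N, ∀ K ≥ N, (superLapL m n ^ K) P = 0 ∧
    F = superGaussMul m n (truncExp (superLapL m n) K P)

theorem isGaussTransform_one : IsGaussTransform (gaussFun m n) one := by
  have h : superLapL m n one = 0 := by
    have hp : ∀ t, pderivL t (one : PG m n) = 0 := by
      intro t
      ext1 s
      simp [pderivL_apply, one]
    have hd : ∀ i : Fin m, coeffDeriv i (one : PG m n) = 0 := by
      intro i
      ext1 s
      simp only [coeffDeriv_apply, one]
      split_ifs <;> simp
    simp [superLapL_apply, quad_apply, hp, hd]
  refine ⟨1, fun K hK => ?_⟩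
  obtain ⟨K, rfl⟩ := Nat.exists_eq_add_of_le' hK
  rw [truncExp_apply_of_apply_eq_zero h, superGaussMul_one, pow_succ, Module.End.mul_apply, h,
    map_zero]
  exact ⟨rfl, rfl⟩

theorem IsGaussTransform.step {op : SF m n → SF m n} {X C : Module.End ℂ (PG m n)}
    (hX : superLapL m n * X = X * superLapL m n + (2 : ℂ) • C)
    (hC : superLapL m n * C = C * superLapL m n)
    (hop : ∀ P, op (superGaussMul m n P) = superGaussMul m n (X P + C P))
    {F : SF m n} {P : PG m n} (h : IsGaussTransform F P) : IsGaussTransform (op F) (X P) := by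
  obtain ⟨N, h⟩ := h
  refine ⟨N + 1, fun K hK => ?_⟩
  obtain ⟨K, rfl⟩ := Nat.exists_eq_add_of_le' (le_trans (Nat.le_add_left 1 N) hK)
  have hKN : N ≤ K := by omega
  have h1 := congrArg (fun S : Module.End ℂ (PG m n) => S P)
    (pow_succ_mul_of_central_commutator hX hC K)
  have h2 := congrArg (fun S : Module.End ℂ (PG m n) => S P) (truncExp_succ_mul hX hC K)
  simp only [Module.End.mul_apply, LinearMap.add_apply, LinearMap.smul_apply] at h1 h2
  refine ⟨?_, ?_⟩
  · rw [h1, (h K hKN).1, (h (K + 1) (by omega)).1]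
    simp
  · rw [h2, truncExp_succ_apply_of_pow_eq_zero (h K hKN).1, ← hop, ← (h K hKN).2]

theorem IsGaussTransform.grassOp (A : Finset (Fin (2 * n))) :
    IsGaussTransform (grassOp m n A (gaussFun m n)) (Pi.single A 1) := by
  rw [← foldr_genMul_sort, _root_.grassOp, opProd]
  induction A.sort (· ≤ ·) with
  | nil => exact isGaussTransform_one
  | cons t l ih =>
    exact ih.step (op := fun F x => Dop n t (F x)) (superLapL_mul_genMulC t)
      (superLapL_mul_dualDerivC t) (Dop_superGaussMul t)

theorem IsGaussTransform.bosD_iterate {F : SF m n} {P : PG m n} (h : IsGaussTransform F P)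
    (i : Fin m) (k : ℕ) :
    IsGaussTransform ((bosD m n i)^[k] F) ((X i ^ k : MvPolynomial (Fin m) ℂ) • P) := by
  induction k with
  | zero => simpa using h
  | succ k ih =>
    rw [Function.iterate_succ_apply', pow_succ', mul_smul]
    exact ih.step (superLapL_mul_coeffMul i) (LinearMap.ext fun P => by
      simpa using congrArg (fun S : Module.End ℂ (PG m n) => S P) (superLapL_mul_coeffDeriv i)) (bosD_superGaussMul i)

theorem IsGaussTransform.bosMono {F : SF m n} {P : PG m n} (h : IsGaussTransform F P)
    (d : Fin m →₀ ℕ) :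
    IsGaussTransform (bosMono m n d F) ((monomial d 1 : MvPolynomial (Fin m) ℂ) • P) := by
  have hd : (monomial d 1 : MvPolynomial (Fin m) ℂ)
      = ((List.finRange m).map fun i => X i ^ d i).prod := by
    rw [monomial_eq, Finsupp.prod_fintype _ _ (by simp), Fin.prod_univ_def]
    simp
  rw [hd, _root_.bosMono, opProd]
  induction List.finRange m with
  | nil => simpa using h
  | cons i l ih =>
    rw [List.map_cons, List.map_cons, List.prod_cons, mul_smul]
    exact ih.bosD_iterate i (d i)

theorem IsGaussTransform.smul {F : SF m n} {P : PG m n} (h : IsGaussTransform F P) (c : ℂ) :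
    IsGaussTransform (c • F) (c • P) := by
  obtain ⟨N, h⟩ := h
  refine ⟨N, fun K hK => ?_⟩
  rw [map_smul, map_smul, map_smul, ← (h K hK).2, (h K hK).1]
  exact ⟨smul_zero c, rfl⟩

theorem IsGaussTransform.sum {ι : Type*} (s : Finset ι) {F : ι → SF m n} {P : ι → PG m n}
    (h : ∀ a ∈ s, IsGaussTransform (F a) (P a)) :
    IsGaussTransform (∑ a ∈ s, F a) (∑ a ∈ s, P a) := by
  induction s using Finset.cons_induction with
  | empty => exact ⟨0, fun K _ => by simp⟩
  | cons a s ha ih =>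
    obtain ⟨N, hN⟩ := ih fun b hb => h b (mem_cons_of_mem hb)
    obtain ⟨M, hM⟩ := h a (mem_cons_self a s)
    refine ⟨max M N, fun K hK => ?_⟩
    obtain ⟨h1, h2⟩ := hM K (le_trans (le_max_left _ _) hK)
    obtain ⟨h3, h4⟩ := hN K (le_trans (le_max_right _ _) hK)
    rw [sum_cons, sum_cons, map_add, map_add, map_add, ← h2, ← h4, h1, h3]
    exact ⟨add_zero 0, rfl⟩

theorem isGaussTransform_pOp (H : PG m n) : IsGaussTransform (pOp m n H (gaussFun m n)) H := by
  have hH : H = ∑ A : Finset (Fin (2 * n)), ∑ d ∈ (H A).support,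
      coeff d (H A) • (monomial d 1 : MvPolynomial (Fin m) ℂ) •
        (Pi.single A 1 : PG m n) := by
    ext1 s
    simp only [Finset.sum_apply, Pi.smul_apply, Pi.single_apply, smul_eq_mul, mul_ite, mul_one,
      mul_zero, smul_ite, smul_zero]
    rw [sum_eq_single s]
    · simp [smul_monomial]
    · intro A _ hA
      simp [Ne.symm hA]
    · simp
  nth_rewrite 2 [hH]
  exact .sum _ fun A _ => .sum _ fun d _ => ((IsGaussTransform.grassOp A).bosMono d).smul _

end SuperOperators

end

/-- Let `H ∈ ℂ[x_1,…,x_m] ⊗ Λ_{2n}` be a super spherical harmonic of degree `l`.  Then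
`H(∂_x) exp(x²/2) = H(x) exp(x²/2)`, where `H(∂_x)` is the constant-coefficient
differential operator obtained by substituting `x_i → -∂_{x_i}`,
`x`_{2i} → 2∂_{x`_{2i-1}}` and `x`_{2i-1} → -2∂_{x`_{2i}}` in `H`. -/
theorem harmonic_diff_gauss (m n l : ℕ) (hm : 1 ≤ m) (H : PG m n)
    (hhom : PHomog m n H l) (hharm : superLapP m n H = 0) :
    pOp m n H (gaussFun m n) = fun x => Gr.mul (evalP m n H x) (gaussFun m n x) := by
  obtain ⟨N, h⟩ := isGaussTransform_pOp H
  rw [(h (N + 1) (Nat.le_succ N)).2,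
    truncExp_apply_of_apply_eq_zero ((superLapL_eq_superLapP H).trans hharm),
    superGaussMul_eq_mul]
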